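/- Let G be a finite simple graph, let M be a matching in G, and let ε ∈ (0,1). If |M| < (1 − ε)·k_opt(G), then there exist at least (ε/2)·k_opt(G) pairwise vertex-disjoint augmenting paths for M, each of length at most 4/ε. -/

import Mathlib

/-- A matching in a simple graph `G`: a finite set of edges of `G`,
no two of which share an endpoint. -/
def IsMatching {V : Type*} (G : SimpleGraph V) (M : Finset (Sym2 V)) : Prop :=
  (∀ e ∈ M, e ∈ G.edgeSet) ∧
    ∀ e ∈ M, ∀ f ∈ M, e ≠ f → ∀ v : V, v ∈ e → v ∉ f

/-- An augmenting path for the matching `M`: a (nonempty) simple path whose edges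
alternate between edges of `M` and edges not in `M`, and whose two endpoints are
not covered by any edge of `M`. -/
def IsAugmentingPath {V : Type*} (G : SimpleGraph V) (M : Finset (Sym2 V))
    {u v : V} (w : G.Walk u v) : Prop :=
  w.IsPath ∧ 0 < w.length ∧
    List.Chain' (fun e f => (e ∈ M ↔ f ∉ M)) w.edges ∧
    (∀ e ∈ M, u ∉ e) ∧ (∀ e ∈ M, v ∉ e)

namespace ShortAug

variable {V : Type*} {G : SimpleGraph V}

open SimpleGraph

lemma head_mem {u v : V} (w : G.Walk u v) : ∀ e ∈ w.edges.head?, u ∈ e := by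
  cases w with
  | nil => simp
  | cons h p => simp

lemma endpoint {M : Finset (Sym2 V)} {x : V} (hx : ∀ e ∈ M, x ∉ e) {u v : V} (w : G.Walk u v)
    (hc : List.IsChain (fun e f => (e ∈ M ↔ f ∉ M)) w.edges) (hm : x ∈ w.support) :
    x = u ∨ x = v := by
  induction w with
  | nil => left; simpa using hm
  | @cons u y v h p ih =>
    rw [Walk.edges_cons, List.isChain_cons] at hc
    rw [Walk.support_cons, List.mem_cons] at hm
    rcases hm with hm | hm
    · exact Or.inl hm
    · rcases ih hc.2 hm with h1 | h1
      · subst h1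
        cases p with
        | nil => right; rfl
        | cons h' q =>
          have h2 := hc.1 _ (by simp; rfl)
          by_cases h3 : s(u, x) ∈ M
          · exact absurd (by simp) (hx _ h3)
          · exact absurd (by simp) (hx _ (not_not.1 (fun h4 => h3 (h2.2 h4))))
      · exact Or.inr h1

lemma aug_reverse {M : Finset (Sym2 V)} {u v : V} {w : G.Walk u v} (h : IsAugmentingPath G M w) :
    IsAugmentingPath G M w.reverse := by
  obtain ⟨h1, h2, h3, h4, h5⟩ := h
  refine ⟨h1.reverse, by simpa using h2, ?_, h5, h4⟩
  change List.IsChain _ _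
  rw [Walk.edges_reverse, List.isChain_reverse]
  exact List.IsChain.imp (fun a b hab => by tauto) h3

lemma orient {M : Finset (Sym2 V)} {a : V} (ha : ∀ e ∈ M, a ∉ e) {u v : V} {w : G.Walk u v}
    (h : IsAugmentingPath G M w) (hm : a ∈ w.support) :
    ∃ (z : V) (p : G.Walk a z), IsAugmentingPath G M p ∧ ∀ x, x ∈ p.support ↔ x ∈ w.support := by
  rcases endpoint ha w h.2.2.1 hm with h1 | h1
  · subst h1; exact ⟨v, w, h, fun _ => Iff.rfl⟩
  · subst h1; exact ⟨u, w.reverse, aug_reverse h, fun _ => by simp⟩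

lemma chain_insert [DecidableEq V] {M : Finset (Sym2 V)} {a b u v : V} {w : G.Walk u v}
    (h : List.IsChain (fun e f => (e ∈ M ↔ f ∉ M)) w.edges)
    (hs : a ∉ w.support ∨ b ∉ w.support) :
    List.IsChain (fun e f => (e ∈ insert s(a, b) M ↔ f ∉ insert s(a, b) M)) w.edges := by
  have key : ∀ e ∈ w.edges, e ≠ s(a, b) := by
    rintro e he rfl
    rcases hs with hs | hs
    · exact hs (w.fst_mem_support_of_mem_edges he)
    · exact hs (w.snd_mem_support_of_mem_edges he)
  refine List.IsChain.imp_of_mem_imp (fun e f he hf hef => ?_) h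
  simpa [key e he, key f hf] using hef

lemma aug_insert [DecidableEq V] {M : Finset (Sym2 V)} {a b u v : V} {w : G.Walk u v}
    (h : IsAugmentingPath G M w) (ha : a ∉ w.support) (hb : b ∉ w.support) :
    IsAugmentingPath G (insert s(a, b) M) w := by
  obtain ⟨h1, h2, h3, h4, h5⟩ := h
  refine ⟨h1, h2, chain_insert h3 (Or.inl ha), ?_, ?_⟩
  · intro e he
    rcases Finset.mem_insert.1 he with rfl | he
    · intro h
      rcases Sym2.mem_iff.1 h with rfl | rfl
      · exact ha w.start_mem_support
      · exact hb w.start_mem_support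
    · exact h4 e he
  · intro e he
    rcases Finset.mem_insert.1 he with rfl | he
    · intro h
      rcases Sym2.mem_iff.1 h with rfl | rfl
      · exact ha w.end_mem_support
      · exact hb w.end_mem_support
    · exact h5 e he

lemma end_ne {M : Finset (Sym2 V)} {u v : V} {w : G.Walk u v}
    (h : IsAugmentingPath G M w) : v ≠ u := by
  rintro rfl
  have h2 := h.2.1
  have h1 := h.1
  cases w with
  | nil => simp at h2
  | cons hadj p =>
    rw [Walk.cons_isPath_iff] at h1
    exact h1.2 p.end_mem_support

lemma aug_join [DecidableEq V] {M : Finset (Sym2 V)} {a b u v : V} (hab : G.Adj a b)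
    {p : G.Walk a u} {q : G.Walk b v}
    (hp : IsAugmentingPath G M p) (hq : IsAugmentingPath G M q)
    (hd : ∀ x, x ∈ p.support → x ∉ q.support) :
    IsAugmentingPath G (insert s(a, b) M) (p.reverse.append (Walk.cons hab q)) := by
  have hb : b ∉ p.support := fun h => hd _ h q.start_mem_support
  have ha : a ∉ q.support := hd _ p.start_mem_support
  have hu := end_ne hp
  have hv := end_ne hq
  have hub : u ≠ b := fun h => hb (h ▸ p.end_mem_support)
  have hva : v ≠ a := fun h => ha (h ▸ q.end_mem_support)
  have notin : ∀ e ∈ p.edges.head?, e ∉ insert s(a, b) M := by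
    intro e he h
    rcases Finset.mem_insert.1 h with rfl | h
    · exact hb (p.snd_mem_support_of_mem_edges (List.mem_of_mem_head? he))
    · exact hp.2.2.2.1 e h (head_mem p e he)
  have notin' : ∀ e ∈ q.edges.head?, e ∉ insert s(a, b) M := by
    intro e he h
    rcases Finset.mem_insert.1 h with rfl | h
    · exact ha (q.fst_mem_support_of_mem_edges (List.mem_of_mem_head? he))
    · exact hq.2.2.2.1 e h (head_mem q e he)
  have hpr := aug_reverse hp
  refine ⟨?_, by simp, ?_, ?_, ?_⟩
  · rw [Walk.isPath_def, Walk.support_append, List.nodup_append']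
    refine ⟨hp.1.reverse.support_nodup, by simpa using hq.1.support_nodup, ?_⟩
    intro x hx hx'
    exact hd x (by simpa using hx) (by simpa using hx')
  · change List.IsChain _ _
    rw [Walk.edges_append, List.isChain_append, Walk.edges_cons, List.isChain_cons]
    refine ⟨chain_insert hpr.2.2.1 (Or.inr (by simpa using hb)),
      ⟨?_, chain_insert hq.2.2.1 (Or.inl ha)⟩, ?_⟩
    · intro y hy
      have := notin' y hy
      simp only [this, Finset.mem_insert_self, not_false_eq_true]
    · intro x hx y hy
      rw [Walk.edges_reverse, List.getLast?_reverse] at hx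
      have := notin x hx
      simp only [List.head?_cons, Option.mem_def, Option.some.injEq] at hy
      subst hy
      simp only [this, Finset.mem_insert_self, not_true_eq_false]
  · intro e he
    rcases Finset.mem_insert.1 he with rfl | he
    · simp [hu, hub]
    · exact hp.2.2.2.2 e he
  · intro e he
    rcases Finset.mem_insert.1 he with rfl | he
    · simp [hv, hva]
    · exact hq.2.2.2.2 e he

abbrev Dis (p q : Σ u : V, Σ v : V, G.Walk u v) : Prop :=
  ∀ x : V, x ∈ p.2.2.support → x ∉ q.2.2.support

lemma dis_symm {p q : Σ u : V, Σ v : V, G.Walk u v} (h : Dis p q) : Dis q p :=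
  fun x hx hx' => h x hx' hx

/-- `P` is a disjoint family of augmenting paths inside the vertices covered by `N`. -/
def Good (G : SimpleGraph V) (M N : Finset (Sym2 V))
    (P : List (Σ u : V, Σ v : V, G.Walk u v)) : Prop :=
  (∀ p ∈ P, IsAugmentingPath G M p.2.2 ∧ ∀ x ∈ p.2.2.support, ∃ e ∈ N, x ∈ e) ∧ P.Pairwise Dis

lemma Good.perm {M N : Finset (Sym2 V)} {P Q : List (Σ u : V, Σ v : V, G.Walk u v)}
    (h : Good G M N P) (hPQ : P.Perm Q) : Good G M N Q :=
  ⟨fun p hp => h.1 p (hPQ.mem_iff.2 hp), (hPQ.pairwise_iff dis_symm).1 h.2⟩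

lemma base (N : Finset (Sym2 V)) (hN : IsMatching G N) :
    ∃ P, Good G ∅ N P ∧ N.card ≤ P.length := by
  classical
  induction N using Finset.induction_on with
  | empty => exact ⟨[], ⟨by simp, by simp⟩, by simp⟩
  | insert e N he ih =>
    obtain ⟨P, hP, hlen⟩ := ih ⟨fun f hf => hN.1 f (Finset.mem_insert_of_mem hf),
      fun f hf g hg => hN.2 f (Finset.mem_insert_of_mem hf) g (Finset.mem_insert_of_mem hg)⟩
    induction e using Sym2.ind with
    | _ x y =>
      have hxy : G.Adj x y := hN.1 s(x, y) (Finset.mem_insert_self _ _)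
      refine ⟨⟨x, y, Walk.cons hxy Walk.nil⟩ :: P, ⟨?_, ?_⟩, ?_⟩
      · intro p hp
        rcases List.mem_cons.1 hp with rfl | hp
        · refine ⟨⟨by simp [hxy.ne], by simp, ?_, by simp, by simp⟩, ?_⟩
          · change List.IsChain _ _
            simp
          · intro z hz
            exact ⟨s(x, y), by simp, by simpa using hz⟩
        · refine ⟨(hP.1 p hp).1, fun z hz => ?_⟩
          obtain ⟨f, hf, hzf⟩ := (hP.1 p hp).2 z hz
          exact ⟨f, Finset.mem_insert_of_mem hf, hzf⟩
      · refine List.pairwise_cons.2 ⟨fun p hp z hz hz' => ?_, hP.2⟩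
        obtain ⟨f, hf, hzf⟩ := (hP.1 p hp).2 z hz'
        exact hN.2 s(x, y) (Finset.mem_insert_self _ _) f (Finset.mem_insert_of_mem hf)
          (fun h => he (h ▸ hf)) z (by simpa using hz) hzf
      · rw [Finset.card_insert_of_notMem he, List.length_cons]
        omega

lemma good_insert [DecidableEq V] {M N : Finset (Sym2 V)} {a b : V}
    {P : List (Σ u : V, Σ v : V, G.Walk u v)} (h : Good G M N P)
    (ha : ∀ p ∈ P, a ∉ p.2.2.support) (hb : ∀ p ∈ P, b ∉ p.2.2.support) :
    Good G (insert s(a, b) M) N P :=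
  ⟨fun p hp => ⟨aug_insert (h.1 p hp).1 (ha p hp) (hb p hp), (h.1 p hp).2⟩, h.2⟩

lemma extract {M N : Finset (Sym2 V)} {a : V}
    {P : List (Σ u : V, Σ v : V, G.Walk u v)} (h : Good G M N P)
    (ha : ∃ p ∈ P, a ∈ p.2.2.support) :
    ∃ p Q, P.Perm (p :: Q) ∧ a ∈ p.2.2.support ∧ Good G M N (p :: Q) ∧ Good G M N Q ∧
      ∀ q ∈ Q, a ∉ q.2.2.support := by
  classical
  obtain ⟨p, hp, hap⟩ := ha
  have hperm := List.perm_cons_erase hp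
  have hg := h.perm hperm
  refine ⟨p, P.erase p, hperm, hap, hg, ⟨fun q hq => hg.1 q (List.mem_cons_of_mem _ hq),
    (List.pairwise_cons.1 hg.2).2⟩, fun q hq => (List.pairwise_cons.1 hg.2).1 q hq a hap⟩

lemma main (M N : Finset (Sym2 V)) (hM : IsMatching G M) (hN : IsMatching G N) :
    ∃ P, Good G M N P ∧ N.card ≤ P.length + M.card := by
  classical
  induction M using Finset.induction_on with
  | empty => simpa using base N hN
  | insert e M he ih =>
    obtain ⟨P, hP, hlen⟩ := ih ⟨fun f hf => hM.1 f (Finset.mem_insert_of_mem hf),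
      fun f hf g hg => hM.2 f (Finset.mem_insert_of_mem hf) g (Finset.mem_insert_of_mem hg)⟩
    rw [Finset.card_insert_of_notMem he]
    have hunc : ∀ x ∈ e, ∀ f ∈ M, x ∉ f := fun x hx f hf =>
      hM.2 e (Finset.mem_insert_self _ _) f (Finset.mem_insert_of_mem hf)
        (fun h => he (h ▸ hf)) x hx
    induction e using Sym2.ind with
    | _ a b =>
      have hab : G.Adj a b := hM.1 s(a, b) (Finset.mem_insert_self _ _)
      by_cases h1 : ∃ p ∈ P, a ∈ p.2.2.support
      · obtain ⟨p, Q, hperm, hap, hg, hgQ, haQ⟩ := extract hP h1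
        have hl := hperm.length_eq
        by_cases h2 : ∃ q ∈ Q, b ∈ q.2.2.support
        · obtain ⟨q, R, hperm', hbq, hg', hgR, hbR⟩ := extract hgQ h2
          have hl' := hperm'.length_eq
          have hp := hg.1 p (by simp)
          have hq := hg'.1 q (by simp)
          have hpQ := (List.pairwise_cons.1 hg.2).1
          have hqR := (List.pairwise_cons.1 hg'.2).1
          have hpq : Dis p q := hpQ q (hperm'.mem_iff.2 (by simp))
          have hRQ : ∀ r ∈ R, r ∈ Q := fun r hr => hperm'.mem_iff.2 (by simp [hr])
          obtain ⟨z, w, hw, hws⟩ := orient (hunc a (by simp)) hp.1 hap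
          obtain ⟨z', w', hw', hws'⟩ := orient (hunc b (by simp)) hq.1 hbq
          have hgood := good_insert hgR (fun r hr => haQ r (hRQ r hr)) hbR
          have hsup : ∀ x, x ∈ (w.reverse.append (Walk.cons hab w')).support →
              x ∈ p.2.2.support ∨ x ∈ q.2.2.support := by
            intro x hx
            rw [Walk.support_append] at hx
            simpa [hws, hws'] using hx
          refine ⟨⟨z, z', w.reverse.append (Walk.cons hab w')⟩ :: R, ⟨?_, ?_⟩, ?_⟩
          · intro r hr
            rcases List.mem_cons.1 hr with rfl | hr
            · refine ⟨aug_join hab hw hw' fun x hx hx' =>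
                hpq x ((hws x).1 hx) ((hws' x).1 hx'), fun x hx => ?_⟩
              rcases hsup x hx with h | h
              · exact hp.2 x h
              · exact hq.2 x h
            · exact hgood.1 r hr
          · refine List.pairwise_cons.2 ⟨fun r hr x hx => ?_, hgood.2⟩
            rcases hsup x hx with h | h
            · exact hpQ r (hRQ r hr) x h
            · exact hqR r hr x h
          · simp only [List.length_cons] at *
            omega
        · push Not at h2
          refine ⟨Q, good_insert hgQ haQ h2, ?_⟩
          simp only [List.length_cons] at *
          omega
      · push Not at h1
        by_cases h2 : ∃ q ∈ P, b ∈ q.2.2.support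
        · obtain ⟨q, R, hperm', hbq, hg', hgR, hbR⟩ := extract hP h2
          have hl' := hperm'.length_eq
          refine ⟨R, good_insert hgR (fun r hr => h1 r (hperm'.mem_iff.2 (by simp [hr]))) hbR, ?_⟩
          simp only [List.length_cons] at *
          omega
        · push Not at h2
          exact ⟨P, good_insert hP h1 h2, by omega⟩

lemma sum_support {M N : Finset (Sym2 V)} {P : List (Σ u : V, Σ v : V, G.Walk u v)}
    (h : Good G M N P) (hp : ∀ p ∈ P, p.2.2.IsPath) :
    (P.map (fun p => p.2.2.support.length)).sum ≤ N.card * 2 := by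
  classical
  rw [← List.length_flatMap]
  have hnd : (P.flatMap (fun p => p.2.2.support)).Nodup := by
    rw [List.nodup_flatMap]
    exact ⟨fun p hpP => (hp p hpP).support_nodup, h.2.imp fun hab x hx hx' => hab x hx hx'⟩
  rw [← List.toFinset_card_of_nodup hnd]
  refine le_trans (Finset.card_le_card (t := N.biUnion Sym2.toFinset) ?_)
    (Finset.card_biUnion_le_card_mul _ _ _ ?_)
  · intro x hx
    simp only [List.mem_toFinset, List.mem_flatMap] at hx
    obtain ⟨p, hpP, hx⟩ := hx
    obtain ⟨e, he, hxe⟩ := (h.1 p hpP).2 x hx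
    simp only [Finset.mem_biUnion, Sym2.mem_toFinset]
    exact ⟨e, he, hxe⟩
  · intro e _
    rw [Sym2.card_toFinset]
    split_ifs <;> omega

end ShortAug

/-- If `|M| < (1-ε) k_opt(G)`, then there are at least `(ε/2) k_opt(G)` pairwise
vertex-disjoint augmenting paths for `M`, each of length at most `4/ε`. -/
theorem many_short_augmenting_paths {V : Type*} [Fintype V]
    (G : SimpleGraph V) (M : Finset (Sym2 V)) (hM : IsMatching G M)
    (ε : ℝ) (hε : ε ∈ Set.Ioo (0 : ℝ) 1) (kopt : ℕ)
    (hkopt : IsGreatest {n | ∃ N : Finset (Sym2 V), IsMatching G N ∧ N.card = n} kopt)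
    (hlt : (M.card : ℝ) < (1 - ε) * kopt) :
    ∃ P : List (Σ u : V, Σ v : V, G.Walk u v),
      (∀ p ∈ P, IsAugmentingPath G M p.2.2 ∧ (p.2.2.length : ℝ) ≤ 4 / ε) ∧
      P.Pairwise (fun p q => ∀ x : V, x ∈ p.2.2.support → x ∉ q.2.2.support) ∧
      (ε / 2) * kopt ≤ (P.length : ℝ) := by
  classical
  obtain ⟨⟨N, hN, hNk⟩, -⟩ := hkopt
  obtain ⟨P, hP, hlen⟩ := ShortAug.main M N hM hN
  obtain ⟨h0, h1⟩ := hε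
  let f : (Σ u : V, Σ v : V, G.Walk u v) → Bool := fun p => decide ((p.2.2.length : ℝ) ≤ 4 / ε)
  have hsplit := List.length_eq_length_filter_add (l := P) f
  refine ⟨P.filter f, ?_, hP.2.filter _, ?_⟩
  · intro p hp
    rw [List.mem_filter] at hp
    exact ⟨(hP.1 p hp.1).1, by simpa [f] using hp.2⟩
  · have hL : ShortAug.Good G M N (P.filter (fun x => !f x)) :=
      ⟨fun p hp => hP.1 p (List.mem_of_mem_filter hp), hP.2.filter _⟩
    have hs := ShortAug.sum_support hL (fun p hp => (hL.1 p hp).1.1)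
    have hlong : ∀ p ∈ P.filter (fun x => !f x), 4 / ε ≤ (p.2.2.support.length : ℝ) := by
      intro p hp
      have h2 := (List.mem_filter.1 hp).2
      have h3 : 4 / ε < (p.2.2.length : ℝ) := by simpa [f] using h2
      rw [SimpleGraph.Walk.length_support]
      push_cast
      linarith
    generalize P.filter (fun x => !f x) = L at *
    have hsum : (L.length : ℝ) * (4 / ε) ≤ ((L.map (fun p => p.2.2.support.length)).sum : ℕ) := by
      clear hs hL hsplit
      induction L with
      | nil => simp
      | cons p L ih =>
        have h2 := hlong p (by simp)
        have h3 := ih fun q hq => hlong q (List.mem_cons_of_mem _ hq)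
        simp only [List.map_cons, List.sum_cons, List.length_cons]
        push_cast at h3 ⊢
        linarith
    have h4 : (L.length : ℝ) * (4 / ε) ≤ kopt * 2 := by
      refine hsum.trans ?_
      rw [← hNk]
      exact_mod_cast hs
    have h5 : (L.length : ℝ) ≤ ε / 2 * kopt := by
      rw [mul_div_assoc', div_le_iff₀ h0] at h4
      linarith
    have h6 : (kopt : ℝ) ≤ (P.filter f).length + L.length + M.card := by
      rw [hsplit, hNk] at hlen
      exact_mod_cast hlen
    linarith
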